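/- arXiv:math/0407078 — 2 statements merged into one kernel-verified Lean document; each statement's English description precedes it below -/
import Mathlib

section
/- For $0<q<1$ and every real $x$ with $|x|<1$, Euler's expansion holds: $1/(x;q)_\infty=\sum_{n\ge 0}\frac{x^n}{(q;q)_n}$, the series converging absolutely. -/
/-- The q-Pochhammer symbol `(q;q)_n = ∏_{j=1}^{n} (1 - qʲ)`. -/
noncomputable def qPochQ (q : ℝ) (n : ℕ) : ℝ := ∏ j ∈ Finset.range n, (1 - q ^ (j + 1))

/-- The infinite q-Pochhammer symbol `(x;q)_∞ = ∏_{n≥0} (1 - qⁿ x)`. -/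
noncomputable def qPochInf (q x : ℝ) : ℝ := ∏' n : ℕ, (1 - q ^ n * x)

theorem qPochQ_succ (q : ℝ) (n : ℕ) : qPochQ q (n + 1) = qPochQ q n * (1 - q ^ (n + 1)) :=
  Finset.prod_range_succ _ _

theorem qPochQ_pos {q : ℝ} (hq : 0 < q) (hq1 : q < 1) (n : ℕ) : 0 < qPochQ q n :=
  Finset.prod_pos fun j _ => sub_pos.2 (pow_lt_one₀ hq.le hq1 j.succ_ne_zero)

theorem summable_pow_div_qPochQ {q x : ℝ} (hq : 0 < q) (hq1 : q < 1) (hx : |x| < 1) :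
    Summable fun n : ℕ => x ^ n / qPochQ q n := by
  obtain ⟨r, hxr, hr⟩ := exists_between hx
  have hlim : Filter.Tendsto (fun n : ℕ => |x| / (1 - q ^ (n + 1))) Filter.atTop (nhds |x|) := by
    have h := (tendsto_pow_atTop_nhds_zero_of_lt_one hq.le hq1).comp (Filter.tendsto_add_atTop_nat 1)
    simpa [Pi.div_def] using (tendsto_const_nhds (x := |x|)).div (h.const_sub 1) (by norm_num)
  refine summable_of_ratio_norm_eventually_le hr ?_
  filter_upwards [hlim.eventually_le_const hxr] with n hn
  have hpos : 0 < 1 - q ^ (n + 1) := sub_pos.2 (pow_lt_one₀ hq.le hq1 n.succ_ne_zero)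
  have heq : ‖x ^ (n + 1) / qPochQ q (n + 1)‖
      = |x| / (1 - q ^ (n + 1)) * ‖x ^ n / qPochQ q n‖ := by
    rw [qPochQ_succ, pow_succ, mul_div_mul_comm, norm_mul, mul_comm, Real.norm_eq_abs (x / _),
      abs_div, abs_of_pos hpos]
  rw [heq]
  gcongr

/-- The `q`-difference equation of the series `∑ xⁿ/(q;q)_n`. -/
theorem one_sub_mul_tsum_pow_div_qPochQ {q x : ℝ} (hq : 0 < q) (hq1 : q < 1) (hx : |x| < 1) :
    (1 - x) * ∑' n : ℕ, x ^ n / qPochQ q n = ∑' n : ℕ, (q * x) ^ n / qPochQ q n := by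
  have hs := summable_pow_div_qPochQ hq hq1 hx
  have hqx : |q * x| < 1 := by
    rw [abs_mul, abs_of_pos hq]
    exact mul_lt_one_of_nonneg_of_lt_one_left hq.le hq1 hx.le
  have hs' := summable_pow_div_qPochQ hq hq1 hqx
  have key : ∑' n : ℕ, x ^ n / qPochQ q n - ∑' n : ℕ, (q * x) ^ n / qPochQ q n
      = x * ∑' n : ℕ, x ^ n / qPochQ q n := by
    rw [← hs.tsum_sub hs', (hs.sub hs').tsum_eq_zero_add, ← tsum_mul_left]
    simp only [pow_zero, sub_self, zero_add]
    refine tsum_congr fun n => ?_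
    have hn := (qPochQ_pos hq hq1 n).ne'
    have hpos : 1 - q ^ (n + 1) ≠ 0 := (sub_pos.2 (pow_lt_one₀ hq.le hq1 n.succ_ne_zero)).ne'
    rw [qPochQ_succ, ← sub_div, mul_pow, ← mul_div_assoc, div_eq_div_iff (mul_ne_zero hn hpos) hn]
    ring
  linear_combination key

theorem abs_pow_mul_le {q : ℝ} (hq : 0 < q) (hq1 : q < 1) (x : ℝ) (N : ℕ) :
    |q ^ N * x| ≤ |x| := by
  rw [abs_mul, abs_of_pos (pow_pos hq N)]
  exact mul_le_of_le_one_left (abs_nonneg x) (pow_le_one₀ hq.le hq1.le)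

theorem prod_mul_tsum_pow_div_qPochQ {q x : ℝ} (hq : 0 < q) (hq1 : q < 1) (hx : |x| < 1)
    (N : ℕ) : (∏ k ∈ Finset.range N, (1 - q ^ k * x)) * ∑' n : ℕ, x ^ n / qPochQ q n
      = ∑' n : ℕ, (q ^ N * x) ^ n / qPochQ q n := by
  induction N with
  | zero => simp
  | succ N ih =>
    rw [Finset.prod_range_succ, mul_right_comm, ih, mul_comm,
      one_sub_mul_tsum_pow_div_qPochQ hq hq1 ((abs_pow_mul_le hq hq1 x N).trans_lt hx),
      pow_succ', mul_assoc]

theorem tendsto_tsum_pow_mul_div_qPochQ {q x : ℝ} (hq : 0 < q) (hq1 : q < 1) (hx : |x| < 1) :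
    Filter.Tendsto (fun N : ℕ => ∑' n : ℕ, (q ^ N * x) ^ n / qPochQ q n) Filter.atTop
      (nhds 1) := by
  have hone : ∑' n : ℕ, (0 : ℝ) ^ n / qPochQ q n = 1 := by
    rw [tsum_eq_single 0 fun n hn => by simp [hn]]
    simp [qPochQ]
  rw [← hone]
  refine tendsto_tsum_of_dominated_convergence (summable_pow_div_qPochQ hq hq1 hx).norm
    (fun n => ?_) (Filter.Eventually.of_forall fun N n => ?_)
  · have h := (tendsto_pow_atTop_nhds_zero_of_lt_one hq.le hq1).mul_const x
    rw [zero_mul] at h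
    exact (h.pow n).div_const _
  · rw [norm_div, norm_div, norm_pow, norm_pow]
    have := abs_pow_mul_le hq hq1 x N
    gcongr
    simpa only [Real.norm_eq_abs] using this

theorem multipliable_one_sub_pow_mul {q : ℝ} (hq : 0 < q) (hq1 : q < 1) (x : ℝ) :
    Multipliable fun n : ℕ => 1 - q ^ n * x := by
  have h : Summable fun n : ℕ => -(q ^ n * x) :=
    ((summable_geometric_of_lt_one hq.le hq1).mul_right x).neg
  simpa only [sub_eq_add_neg] using Real.multipliable_one_add_of_summable h

/-- Euler's expansion: for `0 < q < 1` and `|x| < 1`,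
`1/(x;q)_∞ = ∑_{n≥0} xⁿ/(q;q)_n`, the series converging absolutely. -/
theorem euler_expansion (q x : ℝ) (hq : 0 < q) (hq1 : q < 1) (hx : |x| < 1) :
    (Summable fun n : ℕ => |x ^ n / qPochQ q n|) ∧
      1 / qPochInf q x = ∑' n : ℕ, x ^ n / qPochQ q n := by
  refine ⟨(summable_pow_div_qPochQ hq hq1 hx).abs, ?_⟩
  have hlim := (multipliable_one_sub_pow_mul hq hq1 x).tendsto_prod_tprod_nat.mul_const
    (∑' n : ℕ, x ^ n / qPochQ q n)
  simp only [prod_mul_tsum_pow_div_qPochQ hq hq1 hx] at hlim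
  have hmul : qPochInf q x * ∑' n : ℕ, x ^ n / qPochQ q n = 1 :=
    tendsto_nhds_unique hlim (tendsto_tsum_pow_mul_div_qPochQ hq hq1 hx)
  rw [one_div]
  exact inv_eq_of_mul_eq_one_right hmul
end

section
/- Let $a,z\in(0,1)$. There exists $\epsilon\in(0,1)$ (one may take $\epsilon=z(1-a)$) such that for every $q\in(1-\epsilon,1)$ the function $g(x)=\frac{\phi(a q^{x})}{\phi(q^{1+x})}\,z^x$ on $[0,\infty)$ is integrable, and there exists a unique $x_0\in(0,\infty)$ such that $g$ is increasing on $[0,x_0]$ and decreasing on $[x_0,\infty)$. -/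
/-- `φ(y) = 1/∏_{n≥0}(1 - qⁿ y)`. -/
noncomputable def phi (q y : ℝ) : ℝ := 1 / ∏' n : ℕ, (1 - q ^ n * y)

open Set Filter Topology MeasureTheory

section StrictConcave

/-- A strictly concave continuous function on `[0, ∞)` tending to `-∞` with `F 0 < F 1` increases
up to a unique mode and decreases afterwards. -/
lemma StrictConcaveOn.existsUnique_mode {F : ℝ → ℝ} (hF : StrictConcaveOn ℝ (Ici 0) F)
    (hc : ContinuousOn F (Ici 0)) (hlim : Tendsto F atTop atBot) (h01 : F 0 < F 1) :
    ∃! x₀ : ℝ, x₀ ∈ Ioi (0 : ℝ) ∧ MonotoneOn F (Icc 0 x₀) ∧ AntitoneOn F (Ici x₀) := by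
  obtain ⟨x₀, hx₀, hmax⟩ : ∃ x₀ ∈ Ici (0 : ℝ), IsMaxOn F (Ici 0) x₀ := by
    refine hc.exists_isMaxOn' isClosed_Ici (x₀ := 0) self_mem_Ici ?_
    rw [Filter.eventually_inf_principal, cocompact_eq_atBot_atTop, eventually_sup]
    refine ⟨?_, ?_⟩
    · filter_upwards [eventually_lt_atBot 0] with x hx h
      exact absurd h (not_le.2 hx)
    · filter_upwards [hlim.eventually_le_atBot (F 0)] with x hx _ using hx
  have hpos : 0 < x₀ := by
    refine lt_of_le_of_ne hx₀ ?_
    rintro rfl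
    exact absurd (hmax (mem_Ici.2 zero_le_one)) (not_le.2 h01)
  have key : ∀ x y, 0 ≤ x → 0 ≤ y → ∀ w ∈ segment ℝ x y, min (F x) (F y) ≤ F w :=
    fun x y hx hy w hw => hF.concaveOn.ge_on_segment hx hy hw
  refine ⟨x₀, ⟨hpos, ?_, ?_⟩, ?_⟩
  · intro x hx y hy hxy
    have := key x x₀ hx.1 hx₀ y (by rw [segment_eq_Icc (hxy.trans hy.2)]; exact ⟨hxy, hy.2⟩)
    rwa [min_eq_left (hmax hx.1)] at this
  · intro x hx y hy hxy
    have hx' : x₀ ≤ x := hx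
    have hy0 : 0 ≤ y := hpos.le.trans (hx'.trans hxy)
    have := key x₀ y hx₀ hy0 x (by rw [segment_eq_Icc (hx'.trans hxy)]; exact ⟨hx, hxy⟩)
    rwa [min_eq_right (hmax hy0)] at this
  · rintro y ⟨hy, hmono, hanti⟩
    have hy0 : (0 : ℝ) ≤ y := le_of_lt hy
    refine hF.eq_of_isMaxOn (fun x hx => ?_) hmax hy0 hx₀
    rcases le_total x y with h | h
    · exact hmono ⟨hx, h⟩ ⟨hy0, le_rfl⟩ h
    · exact hanti self_mem_Ici h h

end StrictConcave

section QPochhammer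

variable {q : ℝ}

lemma qPochhammer_factor_pos (hq : q ∈ Ioo (0 : ℝ) 1) {y : ℝ} (hy : y < 1) (n : ℕ) :
    0 < 1 - q ^ n * y := by
  have h1 : q ^ n ≤ 1 := pow_le_one₀ hq.1.le hq.2.le
  have h2 : 0 < q ^ n := pow_pos hq.1 n
  nlinarith

lemma summable_pow_mul_neg (hq : q ∈ Ioo (0 : ℝ) 1) (y : ℝ) :
    Summable fun n : ℕ => -(q ^ n * y) :=
  ((summable_geometric_of_lt_one hq.1.le hq.2).mul_right y).neg

lemma summable_log_qPochhammer (hq : q ∈ Ioo (0 : ℝ) 1) (y : ℝ) :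
    Summable fun n : ℕ => Real.log (1 - q ^ n * y) := by
  simpa only [← sub_eq_add_neg] using
    Real.summable_log_one_add_of_summable (summable_pow_mul_neg hq y)

lemma phi_eq_exp (hq : q ∈ Ioo (0 : ℝ) 1) {y : ℝ} (hy : y < 1) :
    phi q y = Real.exp (-∑' n : ℕ, Real.log (1 - q ^ n * y)) := by
  rw [phi, Real.exp_neg, Real.rexp_tsum_eq_tprod (qPochhammer_factor_pos hq hy)
    (summable_log_qPochhammer hq y), one_div]

lemma phi_pos (hq : q ∈ Ioo (0 : ℝ) 1) {y : ℝ} (hy : y < 1) : 0 < phi q y := by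
  rw [phi_eq_exp hq hy]
  exact Real.exp_pos _

lemma phi_mono (hq : q ∈ Ioo (0 : ℝ) 1) {x y : ℝ} (hxy : x ≤ y) (hy : y < 1) :
    phi q x ≤ phi q y := by
  rw [phi_eq_exp hq hy, phi_eq_exp hq (hxy.trans_lt hy), Real.exp_le_exp, neg_le_neg_iff]
  refine Summable.tsum_le_tsum (fun n => ?_) (summable_log_qPochhammer hq y)
    (summable_log_qPochhammer hq x)
  refine Real.log_le_log (qPochhammer_factor_pos hq hy n) ?_
  have := mul_le_mul_of_nonneg_left hxy (pow_pos hq.1 n).le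
  linarith

lemma phi_zero : phi q 0 = 1 := by simp [phi]

lemma phi_mul_self (hq : q ∈ Ioo (0 : ℝ) 1) {y : ℝ} (hy : y < 1) :
    phi q (q * y) = (1 - y) * phi q y := by
  have h : ∀ n : ℕ, q ^ (n + 1) * y = q ^ n * (q * y) := fun n => by ring
  have hm : Multipliable fun n : ℕ => 1 - q ^ (n + 1) * y := by
    simpa only [h, ← sub_eq_add_neg] using
      Real.multipliable_one_add_of_summable (summable_pow_mul_neg hq (q * y))
  have hne : 1 - y ≠ 0 := by linarith
  rw [phi, phi, tprod_eq_zero_mul' (f := fun n : ℕ => 1 - q ^ n * y) hm]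
  simp only [h, pow_zero, one_mul]
  rw [one_div, one_div, mul_inv, mul_inv_cancel_left₀ hne]

lemma mul_rpow_lt_one (hq : q ∈ Ioo (0 : ℝ) 1) {x : ℝ} (hx : -1 < x) : q * q ^ x < 1 := by
  have := Real.rpow_lt_one hq.1.le hq.2 (show 0 < 1 + x by linarith)
  rwa [Real.rpow_add hq.1, Real.rpow_one] at this

lemma strictConcaveOn_log_sub_log (hq : q ∈ Ioo (0 : ℝ) 1) {a : ℝ} (ha : 0 < a) (haq : a < q) :
    StrictConcaveOn ℝ (Ioi (-1))
      (fun x : ℝ => Real.log (1 - q * q ^ x) - Real.log (1 - a * q ^ x)) := by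
  have hpos : ∀ x : ℝ, 0 < q ^ x := fun x => Real.rpow_pos_of_pos hq.1 x
  have h1 : ∀ x : ℝ, -1 < x → 0 < 1 - q * q ^ x := fun x hx => by
    linarith [mul_rpow_lt_one hq hx]
  have h2 : ∀ x : ℝ, -1 < x → 0 < 1 - a * q ^ x := fun x hx => by
    nlinarith [h1 x hx, hpos x]
  have hd : ∀ x : ℝ, -1 < x → HasDerivAt
      (fun x : ℝ => Real.log (1 - q * q ^ x) - Real.log (1 - a * q ^ x))
      (-Real.log q * ((q - a) * (q ^ x / ((1 - q * q ^ x) * (1 - a * q ^ x))))) x := by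
    intro x hx
    have hp : HasDerivAt (fun x : ℝ => q ^ x) (q ^ x * Real.log q) x :=
      (Real.hasStrictDerivAt_const_rpow hq.1 x).hasDerivAt
    have := (((hp.const_mul q).const_sub 1).log (h1 x hx).ne').sub
      (((hp.const_mul a).const_sub 1).log (h2 x hx).ne')
    refine this.congr_deriv ?_
    have e1 := (h1 x hx).ne'
    have e2 := (h2 x hx).ne'
    rw [div_sub_div _ _ e1 e2, mul_div_assoc', mul_div_assoc']
    congr 1
    ring
  refine StrictAntiOn.strictConcaveOn_of_deriv (convex_Ioi _)
    (fun x hx => (hd x hx).continuousAt.continuousWithinAt) ?_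
  rw [interior_Ioi]
  intro x hx y hy hxy
  rw [(hd x hx).deriv, (hd y hy).deriv]
  have hlog : 0 < -Real.log q := neg_pos.2 (Real.log_neg hq.1 hq.2)
  have hu : q ^ y < q ^ x := Real.rpow_lt_rpow_of_exponent_gt hq.1 hq.2 hxy
  refine mul_lt_mul_of_pos_left (mul_lt_mul_of_pos_left ?_ (sub_pos.2 haq)) hlog
  refine div_lt_div₀ hu ?_ (hpos x).le (mul_pos (h1 x hx) (h2 x hx))
  refine mul_le_mul ?_ ?_ (h2 x hx).le (h1 y hy).le
  · nlinarith [hq.1]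
  · nlinarith

/-- The logarithm of `φ(a qˣ) zˣ / φ(q^{1+x})`. -/
noncomputable def logWeight (q a z x : ℝ) : ℝ :=
  x * Real.log z +
    ∑' n : ℕ, (Real.log (1 - q * q ^ (x + n)) - Real.log (1 - a * q ^ (x + n)))

lemma pow_mul_mul_rpow (hq : 0 < q) (c x : ℝ) (n : ℕ) :
    c * q ^ (x + n) = q ^ n * (c * q ^ x) := by
  rw [Real.rpow_add hq, Real.rpow_natCast]
  ring

lemma summable_logWeight_term (hq : q ∈ Ioo (0 : ℝ) 1) (a x : ℝ) :
    Summable fun n : ℕ => Real.log (1 - q * q ^ (x + n)) - Real.log (1 - a * q ^ (x + n)) := by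
  simp only [pow_mul_mul_rpow hq.1]
  exact (summable_log_qPochhammer hq _).sub (summable_log_qPochhammer hq _)

lemma exp_logWeight (hq : q ∈ Ioo (0 : ℝ) 1) {a z x : ℝ} (haq : a < q) (hz : 0 < z)
    (hx : -1 < x) :
    phi q (a * q ^ x) * z ^ x / phi q (q ^ (1 + x)) = Real.exp (logWeight q a z x) := by
  have h1 := mul_rpow_lt_one hq hx
  have h2 : a * q ^ x < 1 :=
    (mul_lt_mul_of_pos_right haq (Real.rpow_pos_of_pos hq.1 x)).trans h1
  rw [logWeight]
  simp only [pow_mul_mul_rpow hq.1]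
  rw [(summable_log_qPochhammer hq _).tsum_sub (summable_log_qPochhammer hq _),
    Real.rpow_add hq.1, Real.rpow_one, phi_eq_exp hq h1, phi_eq_exp hq h2,
    Real.rpow_def_of_pos hz, ← Real.exp_add, ← Real.exp_sub]
  congr 1
  ring

lemma strictConcaveOn_logWeight (hq : q ∈ Ioo (0 : ℝ) 1) {a : ℝ} (ha : 0 < a) (haq : a < q)
    (z : ℝ) : StrictConcaveOn ℝ (Ioi (-1)) (logWeight q a z) := by
  refine ⟨convex_Ioi _, fun x hx y hy hxy s t hs ht hst => ?_⟩
  have hx' : -1 < x := hx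
  have hy' : -1 < y := hy
  have hterm : ∀ n : ℕ, _ := fun n => (strictConcaveOn_log_sub_log hq ha haq).2
    (show x + n ∈ Ioi (-1 : ℝ) from lt_add_of_lt_of_nonneg hx' n.cast_nonneg)
    (show y + n ∈ Ioi (-1 : ℝ) from lt_add_of_lt_of_nonneg hy' n.cast_nonneg)
    (by simpa using hxy) hs ht hst
  have harg : ∀ n : ℕ, s * (x + n) + t * (y + n) = s * x + t * y + n := fun n => by
    linear_combination (n : ℝ) * hst
  simp only [smul_eq_mul, harg] at hterm ⊢
  have hsx := (summable_logWeight_term hq a x).mul_left s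
  have hsy := (summable_logWeight_term hq a y).mul_left t
  have := Summable.tsum_lt_tsum (fun n => (hterm n).le) (hterm 0) (hsx.add hsy)
    (summable_logWeight_term hq a (s * x + t * y))
  rw [hsx.tsum_add hsy, tsum_mul_left, tsum_mul_left] at this
  simp only [logWeight]
  linarith

lemma exp_logWeight_le (hq : q ∈ Ioo (0 : ℝ) 1) {a z x : ℝ} (ha : 0 < a) (haq : a < q)
    (hz : 0 < z) (hx : 0 ≤ x) :
    Real.exp (logWeight q a z x) ≤ phi q a * Real.exp (Real.log z * x) := by
  have ha1 : a < 1 := haq.trans hq.2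
  rw [← exp_logWeight hq haq hz (by linarith), Real.rpow_def_of_pos hz]
  have hqx : q ^ (1 + x) < 1 := Real.rpow_lt_one hq.1.le hq.2 (by linarith)
  have h1 : 1 ≤ phi q (q ^ (1 + x)) :=
    phi_zero.symm.le.trans (phi_mono hq (Real.rpow_pos_of_pos hq.1 _).le hqx)
  have h2 : phi q (a * q ^ x) ≤ phi q a :=
    phi_mono hq (mul_le_of_le_one_right ha.le (Real.rpow_le_one hq.1.le hq.2.le hx)) ha1
  have h3 := phi_pos hq ha1
  refine (div_le_self ?_ h1).trans (mul_le_mul_of_nonneg_right h2 (Real.exp_pos _).le)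
  exact mul_nonneg ((phi_pos hq ((mul_le_of_le_one_right ha.le
    (Real.rpow_le_one hq.1.le hq.2.le hx)).trans_lt ha1)).le) (Real.exp_pos _).le

lemma logWeight_zero_lt_one (hq : q ∈ Ioo (0 : ℝ) 1) {a z : ℝ} (haq : a < q)
    (hz : 0 < z) (h : 1 - q < z * (1 - a)) : logWeight q a z 0 < logWeight q a z 1 := by
  have ha1 : a < 1 := haq.trans hq.2
  rw [← Real.exp_lt_exp, ← exp_logWeight hq haq hz (by norm_num),
    ← exp_logWeight hq haq hz (by norm_num), Real.rpow_add hq.1, Real.rpow_add hq.1]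
  simp only [Real.rpow_zero, Real.rpow_one, mul_one]
  rw [mul_comm a q, phi_mul_self hq ha1, phi_mul_self hq hq.2]
  have hA := phi_pos hq ha1
  have hQ := phi_pos hq hq.2
  rw [div_lt_div_iff₀ hQ (mul_pos (sub_pos.2 hq.2) hQ)]
  nlinarith [mul_pos hA hQ, mul_lt_mul_of_pos_left h (mul_pos hA hQ)]

end QPochhammer

/-- For `a, z ∈ (0,1)` there is `ε ∈ (0,1)` such that for all `q ∈ (1-ε, 1)` the function
`g(x) = φ(a qˣ) zˣ / φ(q^{1+x})` is integrable on `[0,∞)` and there is a unique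
`x₀ ∈ (0,∞)` such that `g` is increasing on `[0,x₀]` and decreasing on `[x₀,∞)`. -/
theorem g_unimodal (a z : ℝ) (ha : a ∈ Set.Ioo (0 : ℝ) 1) (hz : z ∈ Set.Ioo (0 : ℝ) 1) :
    ∃ ε ∈ Set.Ioo (0 : ℝ) 1, ∀ q ∈ Set.Ioo (1 - ε) 1,
      MeasureTheory.IntegrableOn
        (fun x : ℝ => phi q (a * q ^ x) * z ^ x / phi q (q ^ (1 + x))) (Set.Ici 0) ∧
      ∃! x₀ : ℝ, x₀ ∈ Set.Ioi (0 : ℝ) ∧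
        MonotoneOn (fun x : ℝ => phi q (a * q ^ x) * z ^ x / phi q (q ^ (1 + x)))
          (Set.Icc 0 x₀) ∧
        AntitoneOn (fun x : ℝ => phi q (a * q ^ x) * z ^ x / phi q (q ^ (1 + x)))
          (Set.Ici x₀) := by
  obtain ⟨ha0, ha1⟩ := ha
  obtain ⟨hz0, hz1⟩ := hz
  have hε : z * (1 - a) < 1 - a := mul_lt_of_lt_one_left (sub_pos.2 ha1) hz1
  refine ⟨z * (1 - a), ⟨mul_pos hz0 (sub_pos.2 ha1), by linarith⟩, ?_⟩
  rintro q ⟨hq0, hq1⟩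
  have haq : a < q := by linarith
  have hq : q ∈ Ioo (0 : ℝ) 1 := ⟨ha0.trans haq, hq1⟩
  have hsub : Ici (0 : ℝ) ⊆ Ioi (-1) := fun x hx => by
    have hx0 : (0 : ℝ) ≤ x := hx
    exact mem_Ioi.2 (by linarith)
  have hlog : Real.log z < 0 := Real.log_neg hz0 hz1
  have heq : EqOn (fun x : ℝ => phi q (a * q ^ x) * z ^ x / phi q (q ^ (1 + x)))
      (fun x => Real.exp (logWeight q a z x)) (Ici 0) :=
    fun x hx => exp_logWeight hq haq hz0 (hsub hx)
  have hconc := strictConcaveOn_logWeight hq ha0 haq z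
  have hcont : ContinuousOn (logWeight q a z) (Ici 0) :=
    (hconc.concaveOn.continuousOn isOpen_Ioi).mono hsub
  have hlim : Tendsto (logWeight q a z) atTop atBot := by
    rw [← Real.tendsto_exp_comp_nhds_zero]
    have hb : Tendsto (fun x => phi q a * Real.exp (Real.log z * x)) atTop (𝓝 0) := by
      simpa using (Real.tendsto_exp_atBot.comp
        (tendsto_id.const_mul_atTop_of_neg hlog)).const_mul (phi q a)
    refine tendsto_of_tendsto_of_tendsto_of_le_of_le' tendsto_const_nhds hb
      (Eventually.of_forall fun x => (Real.exp_pos _).le) ?_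
    filter_upwards [eventually_ge_atTop 0] with x hx using exp_logWeight_le hq ha0 haq hz0 hx
  refine ⟨?_, ?_⟩
  · rw [integrableOn_congr_fun heq measurableSet_Ici]
    have hint : IntegrableOn (fun x => phi q a * Real.exp (Real.log z * x)) (Ici 0) :=
      (Iff.mpr integrableOn_Ici_iff_integrableOn_Ioi (integrableOn_exp_mul_Ioi hlog 0)).const_mul _
    refine hint.mono' (hcont.rexp.aestronglyMeasurable measurableSet_Ici) ?_
    filter_upwards [ae_restrict_mem measurableSet_Ici] with x hx
    rw [Real.norm_eq_abs, Real.abs_exp]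
    exact exp_logWeight_le hq ha0 haq hz0 hx
  · have hmode := (hconc.subset hsub (convex_Ici 0)).existsUnique_mode hcont hlim
      (logWeight_zero_lt_one hq haq hz0 (by linarith))
    refine (existsUnique_congr fun x₀ => and_congr_right fun hx₀ => ?_).1 hmode
    have hx₀' : (0 : ℝ) ≤ x₀ := le_of_lt hx₀
    rw [(heq.mono Icc_subset_Ici_self).congr_monotoneOn,
      (heq.mono (Ici_subset_Ici.2 hx₀')).congr_antitoneOn]
    simp only [MonotoneOn, AntitoneOn, Real.exp_le_exp]
end
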